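/- arXiv:1011.5204 — 4 statements merged into one kernel-verified Lean document; each statement's English description precedes it below -/
import Mathlib

section
/- Let r : [0,2π] → (0,∞) be a continuous positive function with r(0) = r(2π), extend it 2π-periodically to ℝ, and define f(t) = r(t)·e^{it}. Then sup over pairs t ≠ s with e^{it} ≠ e^{is} of |f(t) − f(s)|/|e^{it} − e^{is}| equals sup over s of limsup_{t → s} |f(t) − f(s)|/|e^{it} − e^{is}| (both taken as values in [0,∞]). -/
open Set Filter Complex

/-- The law of cosines for two points in polar coordinates. -/
theorem dist_sq_polar (x y t s : ℝ) :
    dist ((x : ℂ) * Complex.exp (t * Complex.I)) ((y : ℂ) * Complex.exp (s * Complex.I)) ^ 2 =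
      x ^ 2 + y ^ 2 - 2 * x * y * Real.cos (t - s) := by
  rw [Complex.dist_eq, ← Complex.normSq_eq_norm_sq, Complex.normSq_apply]
  simp only [Complex.sub_re, Complex.sub_im, Complex.re_ofReal_mul, Complex.im_ofReal_mul,
    Complex.exp_ofReal_mul_I_re, Complex.exp_ofReal_mul_I_im, Real.cos_sub]
  linear_combination x ^ 2 * Real.sin_sq_add_cos_sq t + y ^ 2 * Real.sin_sq_add_cos_sq s

theorem edist_polar_div_le_iff (x y t s : ℝ) (l : NNReal) :
    edist ((x : ℂ) * Complex.exp (t * Complex.I)) ((y : ℂ) * Complex.exp (s * Complex.I)) /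
        edist (Complex.exp (t * Complex.I)) (Complex.exp (s * Complex.I)) ≤ l ↔
      x ^ 2 + y ^ 2 - 2 * x * y * Real.cos (t - s) ≤ l ^ 2 * (2 - 2 * Real.cos (t - s)) := by
  rw [ENNReal.div_le_iff_le_mul (Or.inr ENNReal.coe_ne_top) (Or.inl (edist_ne_top _ _)),
    edist_nndist, edist_nndist, ← ENNReal.coe_mul, ENNReal.coe_le_coe, ← NNReal.coe_le_coe,
    NNReal.coe_mul, coe_nndist, coe_nndist, ← sq_le_sq₀ dist_nonneg (by positivity), mul_pow,
    dist_sq_polar]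
  have h := dist_sq_polar 1 1 t s
  simp only [Complex.ofReal_one, one_mul] at h
  rw [h]
  ring_nf

/-- A continuous function whose increments near each point `s` are at most `K * |t - s|` has
increments at most `K * |t - s|` globally. -/
theorem sub_le_mul_sub_of_eventually {a : ℝ → ℝ} (ha : Continuous a) {K : ℝ}
    (h : ∀ K' > K, ∀ s, ∀ᶠ t in nhdsWithin s {s}ᶜ, |a t - a s| ≤ K' * |t - s|)
    {s t : ℝ} (hst : s ≤ t) : a t - a s ≤ K * (t - s) := by
  have key := image_le_of_liminf_slope_right_le_deriv_boundary (f := a) (a := s) (b := t)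
    (B := fun x => a s + K * (x - s)) (B' := fun _ => K) ha.continuousOn (by simp)
    (by fun_prop)
    (fun x _ => by
      have := (((hasDerivAt_id x).sub_const s).const_mul K).const_add (a s)
      simpa using this.hasDerivWithinAt)
    (fun x _ K' hK' => by
      obtain ⟨K'', h1, h2⟩ := exists_between hK'
      have h3 := (h K'' h1 x).filter_mono
        (nhdsWithin_mono x (fun y (hy : y ∈ Ioi x) => ne_of_gt hy))
      refine Eventually.frequently ?_
      filter_upwards [h3, self_mem_nhdsWithin] with z hz hxz
      have hxz' : 0 < z - x := sub_pos.2 hxz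
      rw [abs_of_pos hxz'] at hz
      rw [slope_def_field, div_lt_iff₀ hxz']
      nlinarith [le_abs_self (a z - a x)])
  have := key (right_mem_Icc.2 hst)
  linarith

theorem abs_sub_le_mul_abs_sub_of_eventually {a : ℝ → ℝ} (ha : Continuous a) {K : ℝ}
    (h : ∀ K' > K, ∀ s, ∀ᶠ t in nhdsWithin s {s}ᶜ, |a t - a s| ≤ K' * |t - s|)
    (s t : ℝ) : |a t - a s| ≤ K * |t - s| := by
  wlog hst : s ≤ t generalizing s t
  · rw [abs_sub_comm, abs_sub_comm t s]
    exact this t s (le_of_not_ge hst)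
  have h1 := sub_le_mul_sub_of_eventually ha h hst
  have h2 := sub_le_mul_sub_of_eventually (a := fun x => -a x) ha.neg
    (fun K' hK' s => (h K' hK' s).mono fun t ht => by
      rwa [show -a t - -a s = -(a t - a s) by ring, abs_neg]) hst
  rw [abs_of_nonneg (sub_nonneg.2 hst), abs_le]
  constructor <;> linarith

/-- If `|u - v|` is controlled by the chord `√(2 - 2 cos θ)` near each point as below, then
`arcsin ∘ u` is locally `K'`-Lipschitz at each point for all `K' > 1`. -/
theorem eventually_abs_arcsin_sub_le {u : ℝ → ℝ} (hu : Continuous u) {s : ℝ}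
    (hpos : 0 < u s) (hlt : u s < 1)
    (h : ∀ᶠ t in nhdsWithin s {s}ᶜ,
      u t ^ 2 + u s ^ 2 - 2 * u t * u s * Real.cos (t - s) ≤ 2 - 2 * Real.cos (t - s))
    {K : ℝ} (hK : 1 < K) :
    ∀ᶠ t in nhdsWithin s {s}ᶜ,
      |Real.arcsin (u t) - Real.arcsin (u s)| ≤ K * |t - s| := by
  have hd := Real.hasDerivAt_arcsin (x := u s) (by linarith) hlt.ne
  have hc : ContinuousAt (fun t => |dslope Real.arcsin (u s) (u t)| * √(1 - u t * u s)) s := by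
    have h1 : ContinuousAt (fun t => dslope Real.arcsin (u s) (u t)) s :=
      ContinuousAt.comp (g := dslope Real.arcsin (u s)) (f := u)
        (continuousAt_dslope_same.2 hd.differentiableAt) hu.continuousAt
    exact h1.abs.mul (by fun_prop)
  have hpos' : 0 < 1 - u s * u s := by nlinarith
  have hval : |dslope Real.arcsin (u s) (u s)| * √(1 - u s * u s) < K := by
    rw [dslope_same, hd.deriv, sq, abs_of_pos (by positivity),
      one_div_mul_cancel (Real.sqrt_pos.2 hpos').ne']
    exact hK
  have h2 : ∀ᶠ t in nhds s, 0 < 1 - u t * u s :=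
    ContinuousAt.eventually_lt (f := fun _ => (0 : ℝ)) (by fun_prop) (by fun_prop) hpos'
  filter_upwards [h, nhdsWithin_le_nhds (hc.eventually_lt_const hval),
    nhdsWithin_le_nhds h2] with t ht htK ht2
  have h3 : |u t - u s| ≤ √(1 - u t * u s) * |t - s| := by
    rw [← sq_le_sq₀ (abs_nonneg _) (by positivity), mul_pow, sq_abs, sq_abs,
      Real.sq_sqrt ht2.le]
    nlinarith [Real.one_sub_sq_div_two_le_cos (x := t - s)]
  have h4 := sub_smul_dslope Real.arcsin (u s) (u t)
  rw [← h4, smul_eq_mul, abs_mul]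
  calc |u t - u s| * |dslope Real.arcsin (u s) (u t)|
      ≤ √(1 - u t * u s) * |t - s| * |dslope Real.arcsin (u s) (u t)| := by gcongr
    _ = |dslope Real.arcsin (u s) (u t)| * √(1 - u t * u s) * |t - s| := by ring
    _ ≤ K * |t - s| := by gcongr

theorem sin_sq_add_sin_sq_sub_le {a b c : ℝ} (hc : c ≤ Real.cos (a - b)) :
    Real.sin a ^ 2 + Real.sin b ^ 2 - 2 * Real.sin a * Real.sin b * c ≤ 2 - 2 * c := by
  have hp : Real.sin a * Real.sin b ≤ 1 := by
    nlinarith [Real.sin_sq_le_one a, Real.sin_sq_le_one b, sq_nonneg (Real.sin a - Real.sin b)]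
  have hE : Real.sin a ^ 2 + Real.sin b ^ 2 - 2
      + 2 * Real.cos (a - b) * (1 - Real.sin a * Real.sin b) = -(1 - Real.cos (a - b)) ^ 2 := by
    have h : Real.sin a ^ 2 + Real.sin b ^ 2 - 1 =
        Real.sin a ^ 2 * Real.sin b ^ 2 - Real.cos a ^ 2 * Real.cos b ^ 2 := by
      rw [Real.cos_sq', Real.cos_sq']
      ring
    rw [Real.cos_sub]
    linear_combination h
  nlinarith [sq_nonneg (1 - Real.cos (a - b)),
    mul_nonneg (sub_nonneg.2 hc) (sub_nonneg.2 hp)]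

theorem cos_le_cos_of_periodic {a : ℝ → ℝ} (hper : Function.Periodic a (2 * Real.pi))
    (h : ∀ s t, |a t - a s| ≤ |t - s|) (s t : ℝ) : Real.cos (t - s) ≤ Real.cos (a t - a s) := by
  set k : ℤ := round ((t - s) / (2 * Real.pi)) with hk
  have hpi := Real.pi_pos
  have h1 : |(t - k * (2 * Real.pi)) - s| ≤ Real.pi := by
    have h2 := abs_sub_round ((t - s) / (2 * Real.pi))
    rw [← hk] at h2
    have h3 : (t - k * (2 * Real.pi)) - s = ((t - s) / (2 * Real.pi) - k) * (2 * Real.pi) := by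
      field_simp
      ring
    rw [h3, abs_mul, abs_of_pos (by positivity : 0 < 2 * Real.pi)]
    nlinarith
  have h4 := h s (t - k * (2 * Real.pi))
  rw [hper.sub_int_mul_eq] at h4
  have h5 := Real.cos_le_cos_of_nonneg_of_le_pi (abs_nonneg _) h1 h4
  rwa [Real.cos_abs, Real.cos_abs, sub_right_comm, Real.cos_sub_int_mul_two_pi] at h5

/-- A local bound near each point in the law-of-cosines form is a global one. -/
theorem polar_le_of_eventually {u : ℝ → ℝ} (hu : Continuous u)
    (hper : Function.Periodic u (2 * Real.pi)) (hpos : ∀ t, 0 < u t) (hlt : ∀ t, u t < 1)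
    (h : ∀ s, ∀ᶠ t in nhdsWithin s {s}ᶜ,
      u t ^ 2 + u s ^ 2 - 2 * u t * u s * Real.cos (t - s) ≤ 2 - 2 * Real.cos (t - s))
    (t s : ℝ) :
    u t ^ 2 + u s ^ 2 - 2 * u t * u s * Real.cos (t - s) ≤ 2 - 2 * Real.cos (t - s) := by
  have hlip : ∀ s t, |Real.arcsin (u t) - Real.arcsin (u s)| ≤ |t - s| := fun s t => by
    simpa using abs_sub_le_mul_abs_sub_of_eventually (a := fun t => Real.arcsin (u t)) (K := 1)
      (Real.continuous_arcsin.comp hu)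
      (fun K hK s => eventually_abs_arcsin_sub_le hu (hpos s) (hlt s) (h s) hK) s t
  have hcos := cos_le_cos_of_periodic (a := fun t => Real.arcsin (u t))
    (fun t => by simp only [hper t]) hlip s t
  have hsin : ∀ t, Real.sin (Real.arcsin (u t)) = u t := fun t =>
    Real.sin_arcsin (by linarith [hpos t]) (hlt t).le
  simpa only [hsin] using sin_sq_add_sin_sq_sub_le hcos

theorem le_of_eventually_polar_le {r : ℝ → ℝ} (hrc : Continuous r) {m : ℝ} (hm : 0 ≤ m) {s : ℝ}
    (h : ∀ᶠ t in nhdsWithin s {s}ᶜ,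
      r t ^ 2 + r s ^ 2 - 2 * r t * r s * Real.cos (t - s) ≤ m ^ 2 * (2 - 2 * Real.cos (t - s))) :
    r s ≤ m := by
  have hcos : ∀ᶠ t in nhdsWithin s {s}ᶜ, Real.cos (t - s) < 1 := by
    have h1 : ∀ᶠ t in nhds s, |t - s| < 2 * Real.pi :=
      ContinuousAt.eventually_lt (g := fun _ => 2 * Real.pi) (by fun_prop) (by fun_prop)
        (by simp [Real.pi_pos])
    filter_upwards [nhdsWithin_le_nhds h1, self_mem_nhdsWithin] with t ht hts
    refine lt_of_le_of_ne (Real.cos_le_one _) fun hc => hts ?_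
    have := (Real.cos_eq_one_iff_of_lt_of_lt (abs_lt.1 ht).1 (abs_lt.1 ht).2).1 hc
    exact sub_eq_zero.1 this
  have hle : r s * r s ≤ m ^ 2 := by
    have hT : Tendsto (fun t => r t * r s) (nhdsWithin s {s}ᶜ) (nhds (r s * r s)) :=
      ((hrc.tendsto s).mul_const _).mono_left nhdsWithin_le_nhds
    refine le_of_tendsto hT ?_
    filter_upwards [h, hcos] with t ht hc
    nlinarith [sq_nonneg (r t - r s)]
  exact le_of_sq_le_sq (by nlinarith) hm

/-- main result, Theorem ara: for the polar parametrization
`f(t) = r(t)e^{it}` of a starlike curve (`r` continuous, positive, `2π`-periodic),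
the global supremum of `|f(t) − f(s)|/|e^{it} − e^{is}|` equals the supremum over `s`
of the limsup as `t → s` of the same quotient (values in `[0,∞]`). -/
theorem stmt6 (r : ℝ → ℝ) (hrc : Continuous r) (hrpos : ∀ t, 0 < r t)
    (hrper : Function.Periodic r (2 * Real.pi))
    (f : ℝ → ℂ) (hf : ∀ t, f t = (r t : ℂ) * Complex.exp (t * Complex.I)) :
    (⨆ t : ℝ, ⨆ s : ℝ,
        edist (f t) (f s) /
          edist (Complex.exp (t * Complex.I)) (Complex.exp (s * Complex.I))) =
      ⨆ s : ℝ,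
        Filter.limsup
          (fun t =>
            edist (f t) (f s) /
              edist (Complex.exp (t * Complex.I)) (Complex.exp (s * Complex.I)))
          (nhdsWithin s {s}ᶜ) := by
  simp only [hf]
  apply le_antisymm
  · refine le_of_forall_gt_imp_ge_of_dense fun c hc => ?_
    obtain ⟨l, hl, hlc⟩ := ENNReal.lt_iff_exists_nnreal_btwn.1 hc
    obtain ⟨m, hm, hml⟩ := ENNReal.lt_iff_exists_nnreal_btwn.1 hl
    have hml' : (m : ℝ) < l := by exact_mod_cast hml
    have hl0 : (0 : ℝ) < l := m.coe_nonneg.trans_lt hml'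
    have hev : ∀ s, ∀ᶠ t in nhdsWithin s {s}ᶜ,
        r t ^ 2 + r s ^ 2 - 2 * r t * r s * Real.cos (t - s) ≤
          (m : ℝ) ^ 2 * (2 - 2 * Real.cos (t - s)) := fun s =>
      (eventually_lt_of_limsup_lt ((le_iSup _ s).trans_lt hm)).mono fun t ht =>
        (edist_polar_div_le_iff _ _ _ _ _).1 ht.le
    have hscale : ∀ t s : ℝ,
        (r t / l) ^ 2 + (r s / l) ^ 2 - 2 * (r t / l) * (r s / l) * Real.cos (t - s) =
          (r t ^ 2 + r s ^ 2 - 2 * r t * r s * Real.cos (t - s)) / (l : ℝ) ^ 2 := fun t s => by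
      field_simp
    have hglob := polar_le_of_eventually (u := fun t => r t / l) (hrc.div_const _)
      (fun t => by simp only [hrper t]) (fun t => div_pos (hrpos t) hl0)
      (fun t => (div_lt_one hl0).2
        ((le_of_eventually_polar_le hrc m.coe_nonneg (hev t)).trans_lt hml'))
      (fun s => (hev s).mono fun t ht => by
        rw [hscale, div_le_iff₀ (by positivity), mul_comm _ ((l : ℝ) ^ 2)]
        refine ht.trans ?_
        have := Real.cos_le_one (t - s)
        gcongr
        linarith)
    refine iSup_le fun t => iSup_le fun s => le_trans ?_ hlc.le
    rw [edist_polar_div_le_iff]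
    have := hglob t s
    rwa [hscale, div_le_iff₀ (by positivity), mul_comm _ ((l : ℝ) ^ 2)] at this
  · refine iSup_le fun s => limsup_le_of_le (by isBoundedDefault) (Eventually.of_forall fun t => ?_)
    exact le_iSup_of_le t (le_iSup_of_le s le_rfl)
end

section
/- Let r : [0,2π] → (0,∞) be a continuous positive function with r(0) = r(2π) and let f(t) = r(t)·e^{it}. Then sup_{t ≠ s, t,s ∈ [0,2π]} |f(t) − f(s)|/|t − s| = sup_{e^{it} ≠ e^{is}} |f(t) − f(s)|/|e^{it} − e^{is}| (as values in [0,∞]); that is, the Lipschitz constant of f with respect to the angular distance equals the Lipschitz constant of the induced map F(e^{it}) = f(t) on the unit circle with respect to the chordal distance. -/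
open Set Filter Complex

/-- The law of cosines in half-angle form. -/
theorem norm_polar_sub_sq (R ρ t s : ℝ) :
    ‖(R : ℂ) * Complex.exp (t * Complex.I) - (ρ : ℂ) * Complex.exp (s * Complex.I)‖ ^ 2 =
      (R - ρ) ^ 2 + 4 * (R * ρ) * Real.sin ((t - s) / 2) ^ 2 := by
  have h := Real.cos_sub t s
  rw [show t - s = 2 * ((t - s) / 2) by ring, Real.cos_two_mul, Real.cos_sq'] at h
  rw [Complex.sq_norm, Complex.normSq_apply]
  simp only [Complex.sub_re, Complex.sub_im, Complex.re_ofReal_mul, Complex.im_ofReal_mul,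
    Complex.exp_ofReal_mul_I_re, Complex.exp_ofReal_mul_I_im]
  linear_combination (2 * R * ρ) * h + R ^ 2 * Real.sin_sq_add_cos_sq t +
    ρ ^ 2 * Real.sin_sq_add_cos_sq s

theorem norm_exp_mul_I_sub_sq (t s : ℝ) :
    ‖Complex.exp (t * Complex.I) - Complex.exp (s * Complex.I)‖ ^ 2 =
      4 * Real.sin ((t - s) / 2) ^ 2 := by
  simpa using norm_polar_sub_sq 1 1 t s

theorem norm_exp_mul_I_sub_le (t s : ℝ) :
    ‖Complex.exp (t * Complex.I) - Complex.exp (s * Complex.I)‖ ≤ |t - s| := by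
  refine abs_le_of_sq_le_sq' ?_ (abs_nonneg _) |>.2
  rw [norm_exp_mul_I_sub_sq, sq_abs]
  have h : Real.sin ((t - s) / 2) ^ 2 ≤ ((t - s) / 2) ^ 2 := sq_le_sq.2 Real.abs_sin_le_abs
  linarith

theorem sin_sub_sq_add_eq (a b x : ℝ) :
    (Real.sin a - Real.sin b) ^ 2 + 4 * (Real.sin a * Real.sin b) * x =
      4 * Real.cos ((a + b) / 2) ^ 2 * Real.sin ((a - b) / 2) ^ 2 +
        4 * (Real.sin ((a + b) / 2) ^ 2 - Real.sin ((a - b) / 2) ^ 2) * x := by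
  obtain ⟨m, hm⟩ : ∃ m, m = (a + b) / 2 := ⟨_, rfl⟩
  obtain ⟨d, hd⟩ : ∃ d, d = (a - b) / 2 := ⟨_, rfl⟩
  rw [← hm, ← hd, show a = m + d by rw [hm, hd]; ring, show b = m - d by rw [hm, hd]; ring,
    Real.sin_add, Real.sin_sub]
  linear_combination 4 * x * Real.sin m ^ 2 * Real.sin_sq_add_cos_sq d -
    4 * x * Real.sin d ^ 2 * Real.sin_sq_add_cos_sq m

/-- A function that is `1`-Lipschitz at small scales on an interval is `1`-Lipschitz there. -/
theorem abs_sub_le_of_forall_abs_sub_lt {a : ℝ → ℝ} {u v δ : ℝ} (hδ : 0 < δ)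
    (h : ∀ t ∈ Icc u v, ∀ s ∈ Icc u v, |t - s| < δ → |a t - a s| ≤ |t - s|)
    {t s : ℝ} (ht : t ∈ Icc u v) (hs : s ∈ Icc u v) : |a t - a s| ≤ |t - s| := by
  obtain ⟨N, hN⟩ := exists_nat_gt (|t - s| / δ)
  have hN0 : (0 : ℝ) < N := lt_of_le_of_lt (by positivity) hN
  set p : ℕ → ℝ := fun i => s + (i / N : ℝ) * (t - s) with hp
  have hmem : ∀ i ≤ N, p i ∈ Icc u v := fun i hi =>
    (convex_Icc u v).add_smul_sub_mem hs ht
      ⟨by positivity, (div_le_one hN0).2 (by exact_mod_cast hi)⟩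
  have hstep : ∀ i, |p i - p (i + 1)| = |t - s| / N := by
    intro i
    rw [show p i - p (i + 1) = -((t - s) / N) by simp only [hp]; push_cast; ring, abs_neg,
      abs_div, Nat.abs_cast]
  have hsum := dist_le_range_sum_of_dist_le (f := fun i => a (p i)) (d := fun _ => |t - s| / N) N
    (fun {i} hi => by
      rw [Real.dist_eq, ← hstep i]
      refine h _ (hmem _ hi.le) _ (hmem _ hi) ?_
      rw [hstep, div_lt_iff₀ hN0]
      rwa [div_lt_iff₀ hδ, mul_comm] at hN)
  have hpN : p N = t := by simp only [hp]; field_simp; ring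
  have hp0 : p 0 = s := by simp [hp]
  simp only [hpN, hp0, Finset.sum_const, Finset.card_range, nsmul_eq_mul, Real.dist_eq] at hsum
  rw [abs_sub_comm]
  rwa [mul_div_cancel₀ _ hN0.ne'] at hsum

section Polar

variable {r : ℝ → ℝ} {u v l : ℝ}

/-- The radius of a polar curve is bounded by its Lipschitz constant. -/
theorem radius_le_of_polar_lipschitz (huv : u < v) (hrc : ContinuousOn r (Icc u v))
    (hl : 0 ≤ l)
    (H : ∀ t ∈ Icc u v, ∀ s ∈ Icc u v,
      (r t - r s) ^ 2 + 4 * (r t * r s) * Real.sin ((t - s) / 2) ^ 2 ≤ l ^ 2 * (t - s) ^ 2)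
    {t : ℝ} (ht : t ∈ Icc u v) : r t ≤ l := by
  have hne : (nhdsWithin t (Icc u v \ {t})).NeBot := by
    have : t ∈ closure (Icc u v \ {t}) := by
      have hpre : Preperfect (Icc u v) :=
        isPreconnected_Icc.preperfect_of_nontrivial
          ⟨u, left_mem_Icc.2 huv.le, v, right_mem_Icc.2 huv.le, huv.ne⟩
      exact (accPt_principal_iff_clusterPt.1 (hpre t ht)).mem_closure
    exact mem_closure_iff_nhdsWithin_neBot.1 this
  have hlim : Tendsto (fun s => r t * r s * Real.sinc ((t - s) / 2) ^ 2)
      (nhdsWithin t (Icc u v \ {t})) (nhds (r t * r t * Real.sinc ((t - t) / 2) ^ 2)) := by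
    refine Tendsto.mul (Tendsto.mul tendsto_const_nhds ((hrc t ht).mono sdiff_subset)) ?_
    have : Continuous fun s => Real.sinc ((t - s) / 2) ^ 2 := by fun_prop
    exact (this.tendsto t).mono_left nhdsWithin_le_nhds
  have hle : r t * r t * Real.sinc ((t - t) / 2) ^ 2 ≤ l ^ 2 := by
    refine le_of_tendsto hlim (eventually_nhdsWithin_of_forall fun s hs => ?_)
    have hts : t - s ≠ 0 := sub_ne_zero.2 (Ne.symm hs.2)
    have h := H t ht s hs.1
    rw [Real.sinc_of_ne_zero (by simpa using hts), div_pow, ← mul_div_assoc,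
      div_le_iff₀ (by positivity)]
    nlinarith [sq_nonneg (r t - r s)]
  simp only [sub_self, zero_div, Real.sinc_zero] at hle
  exact le_of_sq_le_sq (by linarith) hl

/-- If the polar curve `sin (a t) * e^{it}` is Lipschitz in the angle with a constant less than
`1`, then `a` is `1`-Lipschitz at small scales. -/
theorem exists_forall_abs_sub_le_of_sin_polar_lipschitz {k : ℝ} (hk : k < 1) {a : ℝ → ℝ}
    (hac : ContinuousOn a (Icc u v))
    (ha : ∀ t ∈ Icc u v, a t ∈ Icc 0 (Real.pi / 2))
    (H : ∀ t ∈ Icc u v, ∀ s ∈ Icc u v,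
      (Real.sin (a t) - Real.sin (a s)) ^ 2 +
        4 * (Real.sin (a t) * Real.sin (a s)) * Real.sin ((t - s) / 2) ^ 2 ≤ k * (t - s) ^ 2) :
    ∃ δ > 0, ∀ t ∈ Icc u v, ∀ s ∈ Icc u v, |t - s| < δ → |a t - a s| ≤ |t - s| := by
  have hcont : Continuous fun p : ℝ × ℝ => Real.sinc (p.1 / 2) ^ 2 * Real.cos (p.2 / 2) ^ 2 := by
    fun_prop
  have hnhds : ∀ᶠ p : ℝ × ℝ in nhds (0, 0),
      k < Real.sinc (p.1 / 2) ^ 2 * Real.cos (p.2 / 2) ^ 2 :=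
    hcont.continuousAt.eventually_const_lt (by simpa using hk)
  obtain ⟨ε, hε, hball⟩ := Metric.eventually_nhds_iff.1 hnhds
  obtain ⟨η, hη, hunif⟩ := Metric.uniformContinuousOn_iff.1
    (isCompact_Icc.uniformContinuousOn_of_continuous hac) ε hε
  refine ⟨min ε η, lt_min hε hη, fun t ht s hs hts => ?_⟩
  by_contra! hlt
  have hd : |a t - a s| < ε := hunif t ht s hs (hts.trans_le (min_le_right _ _))
  have hh : t - s ≠ 0 := by
    intro h0
    rw [sub_eq_zero.1 h0] at hlt
    simp at hlt
  have hklt := hball (y := (t - s, a t - a s)) (by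
    rw [Prod.dist_eq]
    simpa using ⟨hts.trans_le (min_le_left _ _), hd⟩)
  have hda : |a t - a s| ≤ Real.pi / 2 := by
    rw [abs_le]
    constructor <;> linarith [(ha t ht).1, (ha t ht).2, (ha s hs).1, (ha s hs).2]
  have hsin : Real.sin ((t - s) / 2) ^ 2 ≤ Real.sin ((a t - a s) / 2) ^ 2 := by
    rw [← sq_abs, ← sq_abs (Real.sin ((a t - a s) / 2)),
      Real.abs_sin_eq_sin_abs_of_abs_le_pi (by
        rw [abs_div, abs_two]; linarith [Real.pi_pos]),
      Real.abs_sin_eq_sin_abs_of_abs_le_pi (by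
        rw [abs_div, abs_two]; linarith [Real.pi_pos]), abs_div, abs_div, abs_two]
    have h0 := abs_nonneg (t - s)
    exact pow_le_pow_left₀ (Real.sin_nonneg_of_nonneg_of_le_pi (by linarith)
      (by linarith [Real.pi_pos]))
      (Real.sin_le_sin_of_le_of_le_pi_div_two (by linarith) (by linarith [Real.pi_pos])
        (by linarith)) 2
  have hH := H t ht s hs
  rw [sin_sub_sq_add_eq] at hH
  dsimp only at hklt
  rw [Real.sinc_of_ne_zero (by simpa using hh), div_pow, div_mul_eq_mul_div,
    lt_div_iff₀ (by positivity), Real.cos_sq'] at hklt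
  have hcos := mul_le_mul_of_nonneg_left hsin (sq_nonneg (Real.cos ((a t + a s) / 2)))
  rw [Real.cos_sq'] at hcos hH
  linarith

/-- A positive closed polar curve that is Lipschitz in the angle is Lipschitz with any larger
constant with respect to the chord. -/
theorem norm_polar_sub_le_mul_chord {L : ℝ} (hl : 0 ≤ l) (hlL : l < L)
    (hrc : ContinuousOn r (Icc 0 (2 * Real.pi)))
    (hrpos : ∀ t ∈ Icc 0 (2 * Real.pi), 0 < r t) (hrend : r 0 = r (2 * Real.pi))
    (H : ∀ t ∈ Icc 0 (2 * Real.pi), ∀ s ∈ Icc 0 (2 * Real.pi),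
      ‖(r t : ℂ) * Complex.exp (t * Complex.I) - (r s : ℂ) * Complex.exp (s * Complex.I)‖ ≤
        l * |t - s|)
    {t s : ℝ} (ht : t ∈ Icc 0 (2 * Real.pi)) (hs : s ∈ Icc 0 (2 * Real.pi)) :
    ‖(r t : ℂ) * Complex.exp (t * Complex.I) - (r s : ℂ) * Complex.exp (s * Complex.I)‖ ≤
      L * ‖Complex.exp (t * Complex.I) - Complex.exp (s * Complex.I)‖ := by
  have hL : 0 < L := hl.trans_lt hlL
  have H2 : ∀ t ∈ Icc 0 (2 * Real.pi), ∀ s ∈ Icc 0 (2 * Real.pi),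
      (r t - r s) ^ 2 + 4 * (r t * r s) * Real.sin ((t - s) / 2) ^ 2 ≤ l ^ 2 * (t - s) ^ 2 := by
    intro t ht s hs
    rw [← norm_polar_sub_sq, ← sq_abs (t - s), ← mul_pow]
    exact pow_le_pow_left₀ (norm_nonneg _) (H t ht s hs) 2
  set a : ℝ → ℝ := fun t => Real.arcsin (r t / L) with ha_def
  have hsin : ∀ t ∈ Icc 0 (2 * Real.pi), r t = L * Real.sin (a t) := by
    intro t ht
    have hrl := radius_le_of_polar_lipschitz Real.two_pi_pos hrc hl H2 ht
    have hpos : 0 < r t / L := div_pos (hrpos t ht) hL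
    rw [ha_def, Real.sin_arcsin (by linarith) ((div_le_one hL).2 (by linarith)),
      mul_div_cancel₀ _ hL.ne']
  have ha : ∀ t ∈ Icc 0 (2 * Real.pi), a t ∈ Icc 0 (Real.pi / 2) := fun t ht =>
    ⟨Real.arcsin_nonneg.2 (div_pos (hrpos t ht) hL).le, Real.arcsin_le_pi_div_two _⟩
  have hac : ContinuousOn a (Icc 0 (2 * Real.pi)) :=
    Real.continuous_arcsin.comp_continuousOn (hrc.div_const L)
  have hk : l ^ 2 / L ^ 2 < 1 :=
    (div_lt_one (by positivity)).2 (pow_lt_pow_left₀ hlL hl two_ne_zero)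
  obtain ⟨δ, hδ, hloc⟩ := exists_forall_abs_sub_le_of_sin_polar_lipschitz hk hac ha (by
    intro t ht s hs
    have h := H2 t ht s hs
    rw [hsin t ht, hsin s hs] at h
    rw [div_mul_eq_mul_div, le_div_iff₀ (by positivity)]
    linarith)
  have hlip : ∀ {t s : ℝ}, t ∈ Icc 0 (2 * Real.pi) → s ∈ Icc 0 (2 * Real.pi) →
      |a t - a s| ≤ |t - s| := fun ht hs => abs_sub_le_of_forall_abs_sub_lt hδ hloc ht hs
  have h0 : (0 : ℝ) ∈ Icc 0 (2 * Real.pi) := left_mem_Icc.2 Real.two_pi_pos.le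
  have h2 : 2 * Real.pi ∈ Icc 0 (2 * Real.pi) := right_mem_Icc.2 Real.two_pi_pos.le
  have haend : a 0 = a (2 * Real.pi) := by simp only [ha_def, hrend]
  -- the complementary arc passes through the common endpoint
  have hcompl : |a t - a s| ≤ 2 * Real.pi - |t - s| := by
    have t0 := abs_le.1 (hlip ht h0)
    have t2 := abs_le.1 (hlip ht h2)
    have s0 := abs_le.1 (hlip hs h0)
    have s2 := abs_le.1 (hlip hs h2)
    rw [abs_of_nonneg (by linarith [ht.1])] at t0
    rw [abs_of_nonpos (by linarith [ht.2])] at t2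
    rw [abs_of_nonneg (by linarith [hs.1])] at s0
    rw [abs_of_nonpos (by linarith [hs.2])] at s2
    rcases abs_cases (t - s) with h | h <;> rw [h.1, abs_le] <;> constructor <;> linarith
  have hsq : Real.sin ((a t - a s) / 2) ^ 2 ≤ Real.sin ((t - s) / 2) ^ 2 := by
    have h1 := Real.cos_le_cos_of_nonneg_of_le_pi (abs_nonneg (a t - a s))
      (y := min |t - s| (2 * Real.pi - |t - s|))
      (by rcases le_total |t - s| Real.pi with h | h
          · exact (min_le_left _ _).trans h
          · exact (min_le_right _ _).trans (by linarith))
      (le_min (hlip ht hs) hcompl)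
    have h3 : Real.cos (min |t - s| (2 * Real.pi - |t - s|)) = Real.cos (t - s) := by
      rcases min_choice |t - s| (2 * Real.pi - |t - s|) with h | h <;> rw [h]
      · exact Real.cos_abs _
      · rw [Real.cos_two_pi_sub, Real.cos_abs]
    rw [h3, Real.cos_abs, show t - s = 2 * ((t - s) / 2) by ring,
      show a t - a s = 2 * ((a t - a s) / 2) by ring, Real.cos_two_mul, Real.cos_two_mul,
      Real.cos_sq', Real.cos_sq'] at h1
    linarith
  refine le_of_sq_le_sq ?_ (by positivity)
  rw [norm_polar_sub_sq, mul_pow, norm_exp_mul_I_sub_sq, hsin t ht, hsin s hs]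
  have key : (Real.sin (a t) - Real.sin (a s)) ^ 2 +
      4 * (Real.sin (a t) * Real.sin (a s)) * Real.sin ((t - s) / 2) ^ 2 ≤
        4 * Real.sin ((t - s) / 2) ^ 2 := by
    rw [sin_sub_sq_add_eq]
    have h1 := mul_le_mul_of_nonneg_left hsq (sq_nonneg (Real.cos ((a t + a s) / 2)))
    have h3 : 0 ≤ Real.sin ((a t - a s) / 2) ^ 2 * Real.sin ((t - s) / 2) ^ 2 := by positivity
    rw [Real.cos_sq'] at h1 ⊢
    linarith
  have := mul_le_mul_of_nonneg_left key (sq_nonneg L)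
  linarith

end Polar

/-- l = L: for the polar parametrization `f(t) = r(t)e^{it}`,
`t ∈ [0,2π]`, of a starlike curve, the Lipschitz constant of `f` with respect to the
angular distance `|t − s|` equals the Lipschitz constant with respect to the chordal
distance `|e^{it} − e^{is}|` (values in `[0,∞]`). -/
theorem stmt7 (r : ℝ → ℝ) (hrc : ContinuousOn r (Icc (0 : ℝ) (2 * Real.pi)))
    (hrpos : ∀ t ∈ Icc (0 : ℝ) (2 * Real.pi), 0 < r t)
    (hrend : r 0 = r (2 * Real.pi))
    (f : ℝ → ℂ) (hf : ∀ t, f t = (r t : ℂ) * Complex.exp (t * Complex.I)) :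
    (⨆ t ∈ Icc (0 : ℝ) (2 * Real.pi), ⨆ s ∈ Icc (0 : ℝ) (2 * Real.pi),
        edist (f t) (f s) / edist t s) =
    (⨆ t ∈ Icc (0 : ℝ) (2 * Real.pi), ⨆ s ∈ Icc (0 : ℝ) (2 * Real.pi),
        edist (f t) (f s) /
          edist (Complex.exp (t * Complex.I)) (Complex.exp (s * Complex.I))) := by
  apply le_antisymm
  · refine iSup₂_mono fun t _ => iSup₂_mono fun s _ => ENNReal.div_le_div_left ?_ _
    rw [edist_dist, edist_dist, Complex.dist_eq, Real.dist_eq]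
    exact ENNReal.ofReal_le_ofReal (norm_exp_mul_I_sub_le t s)
  · generalize hM : (⨆ t ∈ Icc (0 : ℝ) (2 * Real.pi), ⨆ s ∈ Icc (0 : ℝ) (2 * Real.pi),
        edist (f t) (f s) / edist t s) = M
    induction M with
    | top => exact le_top
    | coe l =>
      have H : ∀ t ∈ Icc 0 (2 * Real.pi), ∀ s ∈ Icc 0 (2 * Real.pi),
          ‖(r t : ℂ) * Complex.exp (t * Complex.I) - (r s : ℂ) * Complex.exp (s * Complex.I)‖ ≤
            (l : ℝ) * |t - s| := by
        intro t ht s hs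
        rcases eq_or_ne t s with rfl | hts
        · simp
        have hts' : edist t s ≠ 0 := (edist_pos.2 hts).ne'
        have hle : edist (f t) (f s) / edist t s ≤ l := hM ▸
          le_iSup₂_of_le t ht (le_iSup₂_of_le s hs le_rfl)
        rw [ENNReal.div_le_iff hts' (edist_ne_top _ _), edist_nndist,
          edist_nndist, ← ENNReal.coe_mul, ENNReal.coe_le_coe, ← NNReal.coe_le_coe,
          NNReal.coe_mul, coe_nndist, coe_nndist, Complex.dist_eq, Real.dist_eq, hf, hf] at hle
        exact hle
      refine iSup₂_le fun t ht => iSup₂_le fun s hs => ENNReal.div_le_of_le_mul ?_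
      rw [edist_nndist, edist_nndist, ← ENNReal.coe_mul, ENNReal.coe_le_coe, ← NNReal.coe_le_coe,
        NNReal.coe_mul, coe_nndist, coe_nndist, Complex.dist_eq, Complex.dist_eq, hf, hf]
      refine ge_of_tendsto (x := nhdsWithin (l : ℝ) (Ioi l))
        (((continuous_id.mul continuous_const).tendsto (l : ℝ)).mono_left nhdsWithin_le_nhds)
        (eventually_nhdsWithin_of_forall fun L hL => ?_)
      exact norm_polar_sub_le_mul_chord l.2 hL hrc hrpos hrend H ht hs
end

section
/- Let 0 ≤ k < 1, let p > 0 (playing the role of ψ'(t)) and let σ ∈ (0,1] (playing the role of sin α_t). If (p² + (1 − 2p)σ²)/(p² + (1 + 2p)σ²) ≤ k², then (1 − k)/(1 + k) ≤ p ≤ (1 + k)/(1 − k) and σ ≥ (1 − k)/(1 + k). -/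
/-- pointwise content of (i') and (ii'): if `0 ≤ k < 1`, `p > 0`,
`σ ∈ (0,1]` and `(p² + (1−2p)σ²)/(p² + (1+2p)σ²) ≤ k²`, then
`(1−k)/(1+k) ≤ p ≤ (1+k)/(1−k)` and `σ ≥ (1−k)/(1+k)`. -/
theorem stmt16 (k p σ : ℝ) (hk0 : 0 ≤ k) (hk1 : k < 1) (hp : 0 < p)
    (hσ0 : 0 < σ) (hσ1 : σ ≤ 1)
    (h : (p ^ 2 + (1 - 2 * p) * σ ^ 2) / (p ^ 2 + (1 + 2 * p) * σ ^ 2) ≤ k ^ 2) :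
    (1 - k) / (1 + k) ≤ p ∧ p ≤ (1 + k) / (1 - k) ∧ (1 - k) / (1 + k) ≤ σ := by
  have hk : 0 < 1 - k := by linarith
  have hk' : 0 < 1 + k := by linarith
  have ha : 0 < 1 - k ^ 2 := by nlinarith
  have hquad : (1 - k ^ 2) * p ^ 2 - 2 * (1 + k ^ 2) * σ ^ 2 * p + (1 - k ^ 2) * σ ^ 2 ≤ 0 := by
    rw [div_le_iff₀ (by positivity)] at h
    linarith
  have hσ2 : σ ^ 2 ≤ 1 := pow_le_one₀ hσ0.le hσ1
  have hlin : 0 ≤ 2 * (1 + k ^ 2) * p - (1 - k ^ 2) := by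
    refine nonneg_of_mul_nonneg_right ?_ (pow_pos hσ0 2)
    nlinarith [mul_nonneg ha.le (sq_nonneg p)]
  have hfactor : ((1 + k) * p - (1 - k)) * ((1 - k) * p - (1 + k)) ≤ 0 := by
    nlinarith [mul_nonneg hlin (sub_nonneg.2 hσ2)]
  refine ⟨?_, ?_, ?_⟩
  · rw [div_le_iff₀ hk']
    by_contra! hlt
    have h2 : (1 - k) * p - (1 + k) < 0 := by nlinarith
    nlinarith [mul_pos_of_neg_of_neg (show (1 + k) * p - (1 - k) < 0 by linarith) h2]
  · rw [le_div_iff₀ hk]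
    by_contra! hlt
    have h1 : 0 < (1 + k) * p - (1 - k) := by nlinarith
    nlinarith [mul_pos h1 (show 0 < (1 - k) * p - (1 + k) by linarith)]
  · have hdisc : 0 ≤ ((1 + k ^ 2) * σ) ^ 2 - (1 - k ^ 2) ^ 2 := by
      refine nonneg_of_mul_nonneg_right ?_ (pow_pos hσ0 2)
      nlinarith [mul_nonneg ha.le (neg_nonneg.2 hquad),
        sq_nonneg ((1 - k ^ 2) * p - (1 + k ^ 2) * σ ^ 2)]
    have hσk : 1 - k ^ 2 ≤ (1 + k ^ 2) * σ :=
      (sq_le_sq₀ ha.le (by positivity)).1 (sub_nonneg.1 hdisc)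
    rw [div_le_iff₀ hk']
    refine le_of_mul_le_mul_right ?_ hk'
    nlinarith [mul_nonneg hk0 hσ0.le]
end

section
/- Let 0 < b ≤ a with a² ≤ 2b², and define r(t) = (cos²t/a² + sin²t/b²)^{−1/2}, the polar radius of the ellipse x²/a² + y²/b² = 1. Then max_{t ∈ [0,2π]} √(r(t)² + r'(t)²) = a; consequently the polar parametrization f(t) = r(t)e^{it} of the ellipse satisfies sup_{e^{it} ≠ e^{is}} |f(t) − f(s)|/|e^{it} − e^{is}| = a. -/
open Set Complex

/-- The core algebraic estimate: with `p = √(1 + c sin² t)`, `q = √(1 + c sin² s)`,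
`m = cos (t - s)` and `n = cos (t + s)` the hypotheses hold. -/
lemma sq_sub_le_of_sq_sub_sq_eq {c p q m n : ℝ} (hc0 : 0 ≤ c) (hc1 : c ≤ 1)
    (hp : 1 ≤ p) (hq : 1 ≤ q) (hm : -1 ≤ m) (hm' : m ≤ 1) (hn : -1 ≤ n) (hn' : n ≤ 1)
    (h : (p ^ 2 - q ^ 2) ^ 2 = c ^ 2 * (1 - m ^ 2) * (1 - n ^ 2))
    (h' : c * (1 - m * n) ≤ (p * q) ^ 2 - 1) :
    (p - q) ^ 2 ≤ 2 * (1 - m) * (p * q) * (p * q - 1) := by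
  have hP : 1 ≤ p * q := one_le_mul_of_one_le_of_one_le hp hq
  have hmn : (1 + m) * (1 - n ^ 2) ≤ 4 * (1 - m * n) := by
    nlinarith [mul_nonneg (sub_nonneg.2 hm') (neg_le_iff_add_nonneg.1 hn),
      mul_nonneg (by linarith : 0 ≤ 1 + m) (sq_nonneg (1 - n))]
  have hmn0 : 0 ≤ (1 + m) * (1 - n ^ 2) :=
    mul_nonneg (by linarith) (by nlinarith)
  have h1 : c ^ 2 * ((1 + m) * (1 - n ^ 2)) ≤ 4 * (c * (1 - m * n)) := by
    nlinarith [mul_le_mul_of_nonneg_left hmn hc0,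
      mul_nonneg (mul_nonneg hc0 (sub_nonneg.2 hc1)) hmn0]
  have h2 : 4 * ((p * q) ^ 2 - 1) ≤ 8 * ((p * q) * (p * q - 1)) := by
    nlinarith [sq_nonneg (p * q - 1)]
  have h3 : (0 : ℝ) ≤ (p * q) * (p * q - 1) := mul_nonneg (by linarith) (by linarith)
  have h4 : 4 ≤ (p + q) ^ 2 := by nlinarith
  have h5 : c ^ 2 * ((1 + m) * (1 - n ^ 2)) ≤ 2 * ((p * q) * (p * q - 1)) * (p + q) ^ 2 := by
    nlinarith [mul_le_mul_of_nonneg_left h4 h3]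
  refine le_of_mul_le_mul_right ?_ (by linarith : 0 < (p + q) ^ 2)
  calc (p - q) ^ 2 * (p + q) ^ 2 = (1 - m) * (c ^ 2 * ((1 + m) * (1 - n ^ 2))) := by
        linear_combination h
    _ ≤ (1 - m) * (2 * ((p * q) * (p * q - 1)) * (p + q) ^ 2) :=
        mul_le_mul_of_nonneg_left h5 (by linarith)
    _ = _ := by ring

lemma one_le_sqrt_one_add_mul_sin_sq {c : ℝ} (hc : 0 ≤ c) (t : ℝ) :
    1 ≤ √(1 + c * Real.sin t ^ 2) :=
  Real.one_le_sqrt.2 (le_add_of_nonneg_right (by positivity))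

lemma hasDerivAt_div_sqrt_one_add_mul_sin_sq {c : ℝ} (hc : 0 ≤ c) (a t : ℝ) :
    HasDerivAt (fun t => a / √(1 + c * Real.sin t ^ 2))
      (-(a * c * Real.sin t * Real.cos t) / √(1 + c * Real.sin t ^ 2) ^ 3) t := by
  have hu : 0 < 1 + c * Real.sin t ^ 2 := by positivity
  have h := ((((Real.hasDerivAt_sin t).pow 2).const_mul c).const_add 1).sqrt hu.ne'
  have h2 := (hasDerivAt_const t a).div h (Real.sqrt_pos.2 hu).ne'
  refine h2.congr_deriv ?_
  have := (Real.sqrt_pos.2 hu).ne'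
  simp only [Pi.pow_apply]
  field_simp
  simp
  ring

lemma polar_speed_sq_le {a c : ℝ} (hc0 : 0 ≤ c) (hc1 : c ≤ 1) (t : ℝ) :
    (a / √(1 + c * Real.sin t ^ 2)) ^ 2 +
      (-(a * c * Real.sin t * Real.cos t) / √(1 + c * Real.sin t ^ 2) ^ 3) ^ 2 ≤ a ^ 2 := by
  have hu : 1 ≤ 1 + c * Real.sin t ^ 2 := le_add_of_nonneg_right (by positivity)
  have hp := Real.sq_sqrt (zero_le_one.trans hu)
  rw [div_pow, div_pow, pow_right_comm, hp]
  have hcos := Real.sin_sq_add_cos_sq t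
  set x := Real.sin t ^ 2 with hx
  have hx0 : 0 ≤ x := sq_nonneg _
  have hx1 : 0 ≤ Real.cos t ^ 2 := sq_nonneg _
  have key : c ^ 2 * x * (1 - x) ≤ (1 + c * x) ^ 2 * (c * x) := by
    have : c * (1 - x) ≤ (1 + c * x) ^ 2 := by nlinarith [mul_nonneg hc0 hx0]
    nlinarith [mul_le_mul_of_nonneg_right this (mul_nonneg hc0 hx0)]
  have e : (-(a * c * Real.sin t * Real.cos t)) ^ 2 = a ^ 2 * (c ^ 2 * x * (1 - x)) := by
    rw [← hcos, hx]; ring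
  have hu0 : 0 < 1 + c * x := by linarith
  rw [e]
  calc _ = a ^ 2 * ((1 + c * x) ^ 2 + c ^ 2 * x * (1 - x)) / (1 + c * x) ^ 3 := by field_simp
    _ ≤ a ^ 2 := by
      rw [div_le_iff₀ (by positivity)]
      refine mul_le_mul_of_nonneg_left ?_ (sq_nonneg a)
      linear_combination key

lemma norm_sq_ofReal_mul_exp_sub (x y t s : ℝ) :
    ‖(x : ℂ) * exp (t * I) - y * exp (s * I)‖ ^ 2 =
      (x - y) ^ 2 + 2 * (x * y) * (1 - Real.cos (t - s)) := by
  rw [← normSq_eq_norm_sq, exp_mul_I, exp_mul_I, normSq_apply, Real.cos_sub]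
  simp only [sub_re, sub_im, re_ofReal_mul, im_ofReal_mul, add_re, add_im, mul_I_re, mul_I_im,
    cos_ofReal_re, cos_ofReal_im, sin_ofReal_re, sin_ofReal_im]
  linear_combination x ^ 2 * Real.sin_sq_add_cos_sq t + y ^ 2 * Real.sin_sq_add_cos_sq s

lemma norm_polar_sub_le {a c : ℝ} (ha : 0 ≤ a) (hc0 : 0 ≤ c) (hc1 : c ≤ 1) (t s : ℝ) :
    ‖((a / √(1 + c * Real.sin t ^ 2) : ℝ) : ℂ) * exp (t * I) -
      ((a / √(1 + c * Real.sin s ^ 2) : ℝ) : ℂ) * exp (s * I)‖ ≤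
      a * ‖exp (t * I) - exp (s * I)‖ := by
  refine le_of_sq_le_sq ?_ (by positivity)
  have h1 := norm_sq_ofReal_mul_exp_sub 1 1 t s
  simp only [ofReal_one, one_mul] at h1
  rw [mul_pow, h1, norm_sq_ofReal_mul_exp_sub]
  have hp := one_le_sqrt_one_add_mul_sin_sq hc0 t
  have hq := one_le_sqrt_one_add_mul_sin_sq hc0 s
  have hp2 := Real.sq_sqrt (show 0 ≤ 1 + c * Real.sin t ^ 2 by positivity)
  have hq2 := Real.sq_sqrt (show 0 ≤ 1 + c * Real.sin s ^ 2 by positivity)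
  set p := √(1 + c * Real.sin t ^ 2)
  set q := √(1 + c * Real.sin s ^ 2)
  have ht := Real.sin_sq_add_cos_sq t
  have hs := Real.sin_sq_add_cos_sq s
  have key := sq_sub_le_of_sq_sub_sq_eq hc0 hc1 hp hq (Real.neg_one_le_cos (t - s))
    (Real.cos_le_one _) (Real.neg_one_le_cos (t + s)) (Real.cos_le_one _)
    (by
      rw [← Real.sin_sq, ← Real.sin_sq, hp2, hq2, Real.sin_sub, Real.sin_add]
      have : Real.sin t ^ 2 - Real.sin s ^ 2 =
          (Real.sin t * Real.cos s - Real.cos t * Real.sin s) *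
            (Real.sin t * Real.cos s + Real.cos t * Real.sin s) := by
        linear_combination Real.sin s ^ 2 * ht - Real.sin t ^ 2 * hs
      linear_combination c ^ 2 * (Real.sin t ^ 2 - Real.sin s ^ 2 +
          (Real.sin t * Real.cos s - Real.cos t * Real.sin s) *
            (Real.sin t * Real.cos s + Real.cos t * Real.sin s)) * this)
    (by
      rw [mul_pow, hp2, hq2, Real.cos_sub, Real.cos_add]
      have : 1 - (Real.cos t * Real.cos s + Real.sin t * Real.sin s) *
          (Real.cos t * Real.cos s - Real.sin t * Real.sin s) =
            Real.sin t ^ 2 + Real.sin s ^ 2 := by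
        rw [Real.sin_sq t, Real.sin_sq s]
        linear_combination (Real.sin s ^ 2) * ht + (1 - Real.cos t ^ 2) * hs
      rw [this]
      have : 0 ≤ c ^ 2 * Real.sin t ^ 2 * Real.sin s ^ 2 := by positivity
      linear_combination this)
  have hp0 : 0 < p := by linarith
  have hq0 : 0 < q := by linarith
  have e : a ^ 2 * ((1 - 1) ^ 2 + 2 * 1 * (1 - Real.cos (t - s))) -
      ((a / p - a / q) ^ 2 + 2 * (a / p * (a / q)) * (1 - Real.cos (t - s))) =
      a ^ 2 * (2 * (1 - Real.cos (t - s)) * (p * q) * (p * q - 1) - (p - q) ^ 2) /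
        (p * q) ^ 2 := by
    field_simp
    ring
  rw [← sub_nonneg, e]
  exact div_nonneg (mul_nonneg (sq_nonneg _) (sub_nonneg.2 key)) (sq_nonneg _)

lemma ellipse_polar_radius_eq {a b : ℝ} (ha : 0 < a) (hb : 0 < b) (t : ℝ) :
    (Real.cos t ^ 2 / a ^ 2 + Real.sin t ^ 2 / b ^ 2) ^ (-(1 / 2 : ℝ)) =
      a / √(1 + (a ^ 2 / b ^ 2 - 1) * Real.sin t ^ 2) := by
  have e : 1 + (a ^ 2 / b ^ 2 - 1) * Real.sin t ^ 2 =
      a ^ 2 * (Real.cos t ^ 2 / a ^ 2 + Real.sin t ^ 2 / b ^ 2) := by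
    rw [Real.cos_sq']
    field_simp
    ring
  rw [e, Real.sqrt_mul (sq_nonneg a), Real.sqrt_sq ha.le, Real.rpow_neg (by positivity),
    ← Real.sqrt_eq_rpow, div_mul_cancel_left₀ ha.ne']

/-- for the polar radius `r(t) = (cos²t/a² + sin²t/b²)^{−1/2}` of the
ellipse with semi-axes `0 < b ≤ a`, `a² ≤ 2b²`, one has
`max_{t ∈ [0,2π]} √(r(t)² + r'(t)²) = a`, and hence the chordal Lipschitz constant of
the polar parametrization `f(t) = r(t)e^{it}` equals `a`. -/
theorem stmt18 (a b : ℝ) (hb : 0 < b) (hba : b ≤ a) (hab : a ^ 2 ≤ 2 * b ^ 2)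
    (r : ℝ → ℝ)
    (hr : ∀ t, r t =
      (Real.cos t ^ 2 / a ^ 2 + Real.sin t ^ 2 / b ^ 2) ^ (-(1 / 2 : ℝ)))
    (f : ℝ → ℂ) (hf : ∀ t, f t = (r t : ℂ) * Complex.exp (t * Complex.I)) :
    sSup ((fun t => Real.sqrt (r t ^ 2 + deriv r t ^ 2)) ''
        Icc (0 : ℝ) (2 * Real.pi)) = a ∧
    (⨆ t : ℝ, ⨆ s : ℝ,
        edist (f t) (f s) /
          edist (Complex.exp (t * Complex.I)) (Complex.exp (s * Complex.I))) =
      ENNReal.ofReal a := by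
  have ha : 0 < a := hb.trans_le hba
  obtain ⟨c, hc⟩ : ∃ c, c = a ^ 2 / b ^ 2 - 1 := ⟨_, rfl⟩
  have hc0 : 0 ≤ c := by
    rw [hc, sub_nonneg, one_le_div (by positivity)]
    gcongr
  have hc1 : c ≤ 1 := by
    rw [hc, sub_le_iff_le_add, div_le_iff₀ (by positivity)]
    linarith
  obtain rfl : r = fun t => a / √(1 + c * Real.sin t ^ 2) := by
    funext t
    rw [hr, ellipse_polar_radius_eq ha hb, hc]
  constructor
  · refine IsGreatest.csSup_eq ⟨⟨0, ⟨le_rfl, by positivity⟩, ?_⟩, ?_⟩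
    · simp [(hasDerivAt_div_sqrt_one_add_mul_sin_sq hc0 a 0).deriv, Real.sqrt_sq ha.le]
    · rintro _ ⟨t, -, rfl⟩
      simp only [(hasDerivAt_div_sqrt_one_add_mul_sin_sq hc0 a t).deriv]
      exact Real.sqrt_le_iff.2 ⟨ha.le, polar_speed_sq_le hc0 hc1 t⟩
  · apply le_antisymm
    · refine iSup₂_le fun t s => ENNReal.div_le_of_le_mul ?_
      rw [edist_dist, edist_dist, ← ENNReal.ofReal_mul ha.le, dist_eq_norm, dist_eq_norm, hf, hf]
      exact ENNReal.ofReal_le_ofReal (norm_polar_sub_le ha.le hc0 hc1 t s)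
    · refine le_iSup₂_of_le 0 Real.pi ?_
      have h0 : f 0 = a := by simp [hf]
      have hpi : f Real.pi = -a := by simp [hf]
      have hd : dist (a : ℂ) (-a) = a * 2 := by
        rw [dist_eq_norm, sub_neg_eq_add, ← ofReal_add, norm_real, Real.norm_of_nonneg (by positivity), mul_two]
      have hd' : dist (1 : ℂ) (-1) = 2 := by
        rw [dist_eq_norm]
        norm_num
      rw [h0, hpi, exp_pi_mul_I, ofReal_zero, zero_mul, exp_zero, edist_dist, edist_dist, hd, hd',
        ← ENNReal.ofReal_div_of_pos two_pos, mul_div_cancel_right₀ _ two_ne_zero]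
end
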